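/- arXiv:2405.13536 — 5 statements merged into one kernel-verified Lean document; each statement's English description precedes it below -/
import Mathlib

section
/- (Proposition 4.1: single-layer transformers cannot represent additive models.) Let C ≥ 2 be a context length, and let an additive model on V with context length C be given by weight maps w_i : V → ℝ (i = 1,…,C) and offset b ∈ ℝ such that w_i(τ) ≠ 0 for at least one token τ ∈ V and some position i ∈ {2,…,C}. Then there exists no choice of parameters (e, W_Q, W_K, W_V, b_Q, b_K, b_V, P, ffn, cls) of the single-layer, single-head transformer, in either the encoder or the decoder variant, such that F(t) = b + Σ_{i=1}^{n} w_i(t_i) for every sequence t = [t_1,…,t_n] with 1 ≤ n ≤ C. -/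
open scoped BigOperators

noncomputable section

/-- Dot product on `Fin m → ℝ`. -/
def dotp {m : ℕ} (x y : Fin m → ℝ) : ℝ := ∑ i, x i * y i

/-- A single-layer, single-head transformer without positional embeddings. -/
structure Transformer (V : Type*) (d dh : ℕ) where
  e : V → Fin d → ℝ
  WQ : Matrix (Fin d) (Fin dh) ℝ
  WK : Matrix (Fin d) (Fin dh) ℝ
  WV : Matrix (Fin d) (Fin dh) ℝ
  bQ : Fin dh → ℝ
  bK : Fin dh → ℝ
  bV : Fin dh → ℝ
  P : (Fin dh → ℝ) → (Fin d → ℝ)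
  ffn : (Fin d → ℝ) → (Fin d → ℝ)
  cls : (Fin d → ℝ) → (Fin 2 → ℝ)

namespace Transformer

variable {V : Type*} {d dh : ℕ}

/-- Query vector `W_Q^⊤ h + b_Q`. -/
def qvec (T : Transformer V d dh) (h : Fin d → ℝ) : Fin dh → ℝ :=
  fun j => (∑ i, T.WQ i j * h i) + T.bQ j

/-- Key vector `W_K^⊤ h + b_K`. -/
def kvec (T : Transformer V d dh) (h : Fin d → ℝ) : Fin dh → ℝ :=
  fun j => (∑ i, T.WK i j * h i) + T.bK j

/-- Value vector `W_V^⊤ h + b_V`. -/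
def vvec (T : Transformer V d dh) (h : Fin d → ℝ) : Fin dh → ℝ :=
  fun j => (∑ i, T.WV i j * h i) + T.bV j

/-- Attention index set `J_i`: full for the encoder (`dec = false`),
causally masked (`j ≤ i`) for the decoder (`dec = true`). -/
def J (dec : Bool) {n : ℕ} (i : Fin n) : Finset (Fin n) :=
  if dec then Finset.univ.filter (fun j => j ≤ i) else Finset.univ

/-- Pre-softmax exponentiated attention score `exp(q_i ⬝ k_j / √dh)`. -/
def score (T : Transformer V d dh) {n : ℕ} (t : Fin n → V) (i j : Fin n) : ℝ :=
  Real.exp (dotp (T.qvec (T.e (t i))) (T.kvec (T.e (t j))) / Real.sqrt dh)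

/-- Attention weight `α_{ij}`. -/
def attn (T : Transformer V d dh) (dec : Bool) {n : ℕ} (t : Fin n → V) (i j : Fin n) : ℝ :=
  if j ∈ J dec i then T.score t i j / ∑ j' ∈ J dec i, T.score t i j' else 0

/-- Attention output `s_i = Σ_j α_{ij} v_j`. -/
def sout (T : Transformer V d dh) (dec : Bool) {n : ℕ} (t : Fin n → V) (i : Fin n) :
    Fin dh → ℝ :=
  ∑ j, T.attn dec t i j • T.vvec (T.e (t j))

/-- Classification index: first token for the encoder, last token for the decoder. -/
def clsIdx (dec : Bool) {n : ℕ} (hn : 0 < n) : Fin n :=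
  if dec then ⟨n - 1, Nat.sub_lt hn Nat.one_pos⟩ else ⟨0, hn⟩

/-- Log-odds output `F(t) = Δ(cls(ffn(h_r + P(s_r))))`. -/
def F (T : Transformer V d dh) (dec : Bool) {n : ℕ} (hn : 0 < n) (t : Fin n → V) : ℝ :=
  T.cls (T.ffn (T.e (t (clsIdx dec hn)) + T.P (T.sout dec t (clsIdx dec hn)))) 1
    - T.cls (T.ffn (T.e (t (clsIdx dec hn)) + T.P (T.sout dec t (clsIdx dec hn)))) 0

end Transformer

theorem Transformer.sout_const {V : Type*} {d dh : ℕ} (T : Transformer V d dh) (dec : Bool)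
    {n : ℕ} (τ : V) (i : Fin n) :
    T.sout dec (fun _ : Fin n => τ) i = T.vvec (T.e τ) := by
  have hmem : i ∈ Transformer.J dec i := by
    unfold Transformer.J
    split_ifs <;> simp
  have hpos : 0 < ∑ j' ∈ Transformer.J dec i, T.score (fun _ : Fin n => τ) i j' :=
    Finset.sum_pos (fun j _ => Real.exp_pos _) ⟨i, hmem⟩
  unfold Transformer.sout
  rw [← Finset.sum_smul]
  have h1 : ∑ j, T.attn dec (fun _ : Fin n => τ) i j = 1 := by
    unfold Transformer.attn
    rw [Finset.sum_ite_mem, Finset.univ_inter, ← Finset.sum_div]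
    exact div_self hpos.ne'
  rw [h1, one_smul]

theorem Transformer.F_const {V : Type*} {d dh : ℕ} (T : Transformer V d dh) (dec : Bool)
    {n : ℕ} (hn : 0 < n) (τ : V) :
    T.F dec hn (fun _ : Fin n => τ) =
      T.cls (T.ffn (T.e τ + T.P (T.vvec (T.e τ)))) 1
        - T.cls (T.ffn (T.e τ + T.P (T.vvec (T.e τ)))) 0 := by
  unfold Transformer.F
  rw [Transformer.sout_const]

/-- Proposition 4.1: single-layer, single-head transformers (encoder or
decoder variant) cannot represent any additive model whose weight maps `w_i : V → ℝ`
are nonzero at some position `i ∈ {2,…,C}` (positions are indexed here by `Fin C`,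
with position `i+1` corresponding to index `i`, so "some position in `{2,…,C}`"
means some index `i : Fin C` with `0 < i`). -/
theorem transformer_cannot_represent_additive {V : Type*} [Fintype V]
    (C : ℕ) (hC : 2 ≤ C) (w : Fin C → V → ℝ) (b : ℝ)
    (hw : ∃ (τ : V) (i : Fin C), 0 < (i : ℕ) ∧ w i τ ≠ 0) :
    ¬ ∃ (d dh : ℕ) (_ : 1 ≤ d) (_ : 1 ≤ dh) (T : Transformer V d dh) (dec : Bool),
        ∀ (n : ℕ) (hn : 1 ≤ n) (hnC : n ≤ C) (t : Fin n → V),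
          T.F dec hn t = b + ∑ i : Fin n, w (Fin.castLE hnC i) (t i) := by
  rintro ⟨d, dh, _, _, T, dec, h⟩
  obtain ⟨τ, ⟨i, hi⟩, hpos, hne⟩ := hw
  have hpos' : 0 < i := hpos
  have h1 := h i hpos' hi.le (fun _ => τ)
  have h2 := h (i + 1) (Nat.succ_pos i) hi (fun _ => τ)
  rw [Transformer.F_const] at h1 h2
  rw [Fin.sum_univ_castSucc] at h2
  apply hne
  have e1 : ∀ x : Fin i, Fin.castLE hi x.castSucc = Fin.castLE hi.le x := fun _ => rfl
  have e2 : Fin.castLE hi (Fin.last i) = ⟨i, hi⟩ := rfl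
  simp only [e1, e2] at h2
  linarith
end
end

section
/- (Corollary 4.3: multi-layer transformers cannot represent additive models.) Let C ≥ 2 be a context length, and let an additive model on V with context length C be given by weight maps w_i : V → ℝ (i = 1,…,C) and offset b ∈ ℝ such that w_i(τ) ≠ 0 for at least one token τ ∈ V and some position i ∈ {2,…,C}. Then for any number of layers L ≥ 1, there exists no choice of parameters of the L-layer transformer (encoder or decoder variant) such that F(t) = b + Σ_{i=1}^{n} w_i(t_i) for every sequence t = [t_1,…,t_n] with 1 ≤ n ≤ C. -/
open scoped BigOperators

noncomputable section

/-- One transformer layer (single attention head) acting on input embeddings. -/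
structure Layer (d dh : ℕ) where
  WQ : Matrix (Fin d) (Fin dh) ℝ
  WK : Matrix (Fin d) (Fin dh) ℝ
  WV : Matrix (Fin d) (Fin dh) ℝ
  bQ : Fin dh → ℝ
  bK : Fin dh → ℝ
  bV : Fin dh → ℝ
  P : (Fin dh → ℝ) → (Fin d → ℝ)
  ffn : (Fin d → ℝ) → (Fin d → ℝ)

/-- Attention index set `J_i`: full for the encoder (`dec = false`),
causally masked (`j ≤ i`) for the decoder (`dec = true`). -/
def J (dec : Bool) {n : ℕ} (i : Fin n) : Finset (Fin n) :=
  if dec then Finset.univ.filter (fun j => j ≤ i) else Finset.univ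

namespace Layer

variable {d dh : ℕ}

/-- Query vector `W_Q^⊤ h + b_Q`. -/
def qvec (L : Layer d dh) (h : Fin d → ℝ) : Fin dh → ℝ :=
  fun j => (∑ i, L.WQ i j * h i) + L.bQ j

/-- Key vector `W_K^⊤ h + b_K`. -/
def kvec (L : Layer d dh) (h : Fin d → ℝ) : Fin dh → ℝ :=
  fun j => (∑ i, L.WK i j * h i) + L.bK j

/-- Value vector `W_V^⊤ h + b_V`. -/
def vvec (L : Layer d dh) (h : Fin d → ℝ) : Fin dh → ℝ :=
  fun j => (∑ i, L.WV i j * h i) + L.bV j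

/-- Pre-softmax exponentiated attention score `exp(q_i ⬝ k_j / √dh)`. -/
def score (L : Layer d dh) {n : ℕ} (h : Fin n → Fin d → ℝ) (i j : Fin n) : ℝ :=
  Real.exp (dotp (L.qvec (h i)) (L.kvec (h j)) / Real.sqrt dh)

/-- Attention weight `α_{ij}`. -/
def attn (L : Layer d dh) (dec : Bool) {n : ℕ} (h : Fin n → Fin d → ℝ) (i j : Fin n) : ℝ :=
  if j ∈ J dec i then L.score h i j / ∑ j' ∈ J dec i, L.score h i j' else 0

/-- Layer output `h_i' = ffn(h_i + P(Σ_j α_{ij} v_j))`. -/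
def out (L : Layer d dh) (dec : Bool) {n : ℕ} (h : Fin n → Fin d → ℝ) :
    Fin n → Fin d → ℝ :=
  fun i => L.ffn (h i + L.P (∑ j, L.attn dec h i j • L.vvec (h j)))

end Layer

/-- An `L`-layer transformer without positional embeddings: an embedding map,
a layer for each `l < L` (given as a family indexed by `ℕ`; only the first `L`
layers are used), and a classification head. -/
structure MLTransformer (V : Type*) (d dh L : ℕ) where
  e : V → Fin d → ℝ
  layer : ℕ → Layer d dh
  cls : (Fin d → ℝ) → (Fin 2 → ℝ)

namespace MLTransformer

variable {V : Type*} {d dh L : ℕ}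

/-- Hidden embeddings `h^{(l)}` after `l` layers: `h^{(0)}_i = e(t_i)` and
`h^{(l+1)} = layer_{l+1}(h^{(l)})`. -/
def hidden (T : MLTransformer V d dh L) (dec : Bool) {n : ℕ} (t : Fin n → V) :
    ℕ → Fin n → Fin d → ℝ
  | 0 => fun i => T.e (t i)
  | l + 1 => (T.layer l).out dec (T.hidden dec t l)

/-- Classification index: first token for the encoder, last token for the decoder. -/
def clsIdx (dec : Bool) {n : ℕ} (hn : 0 < n) : Fin n :=
  if dec then ⟨n - 1, Nat.sub_lt hn Nat.one_pos⟩ else ⟨0, hn⟩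

/-- Log-odds output `F(t) = Δ(cls(h_r^{(L)}))`. -/
def F (T : MLTransformer V d dh L) (dec : Bool) {n : ℕ} (hn : 0 < n) (t : Fin n → V) : ℝ :=
  T.cls (T.hidden dec t L (clsIdx dec hn)) 1 - T.cls (T.hidden dec t L (clsIdx dec hn)) 0

end MLTransformer

lemma attn_sum_one {d dh : ℕ} (A : Layer d dh) (dec : Bool) {n : ℕ}
    (h : Fin n → Fin d → ℝ) (i : Fin n) : ∑ j, A.attn dec h i j = 1 := by
  unfold Layer.attn
  rw [← Finset.sum_filter, ← Finset.sum_div]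
  have hf : Finset.univ.filter (fun j => j ∈ J dec i) = J dec i := by
    ext j; simp
  rw [hf]
  apply div_self
  apply ne_of_gt
  apply Finset.sum_pos
  · intro j _
    exact Real.exp_pos _
  · refine ⟨i, ?_⟩
    unfold J
    split_ifs <;> simp

lemma hidden_const {V : Type*} {d dh L : ℕ} (T : MLTransformer V d dh L) (dec : Bool) (τ : V)
    (l : ℕ) : ∃ c : Fin d → ℝ, ∀ (n : ℕ) (i : Fin n),
      T.hidden dec (fun _ : Fin n => τ) l i = c := by
  induction l with
  | zero => exact ⟨T.e τ, fun n i => rfl⟩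
  | succ l ih =>
    obtain ⟨c, hc⟩ := ih
    refine ⟨(T.layer l).ffn (c + (T.layer l).P ((T.layer l).vvec c)), fun n i => ?_⟩
    simp only [MLTransformer.hidden, Layer.out, hc]
    rw [← Finset.sum_smul, attn_sum_one, one_smul]

/-- Corollary 4.3: multi-layer transformers (any number of layers `L ≥ 1`,
encoder or decoder variant) cannot represent any additive model whose weight maps are
nonzero at some token and some position `i ∈ {2,…,C}` (i.e. some index `i : Fin C`
with `0 < i`), for a context length `C ≥ 2`. -/
theorem multilayer_cannot_represent_additive {V : Type*} [Fintype V]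
    (C : ℕ) (hC : 2 ≤ C) (w : Fin C → V → ℝ) (b : ℝ)
    (hw : ∃ (τ : V) (i : Fin C), 0 < (i : ℕ) ∧ w i τ ≠ 0) :
    ¬ ∃ (L d dh : ℕ) (_ : 1 ≤ L) (_ : 1 ≤ d) (_ : 1 ≤ dh)
        (T : MLTransformer V d dh L) (dec : Bool),
        ∀ (n : ℕ) (hn : 1 ≤ n) (hnC : n ≤ C) (t : Fin n → V),
          T.F dec hn t = b + ∑ i : Fin n, w (Fin.castLE hnC i) (t i) := by
  rintro ⟨L, d, dh, _, _, _, T, dec, hT⟩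
  obtain ⟨τ, i, hi, hne⟩ := hw
  obtain ⟨c, hc⟩ := hidden_const T dec τ L
  have h1 := hT i hi i.isLt.le (fun _ => τ)
  have h2 := hT (i + 1) (Nat.succ_pos _) i.isLt (fun _ => τ)
  simp only [MLTransformer.F, hc] at h1 h2
  rw [Fin.sum_univ_castSucc] at h2
  have e1 : ∀ x : Fin (i : ℕ), Fin.castLE (Nat.succ_le_of_lt i.isLt) x.castSucc
      = Fin.castLE i.isLt.le x := fun x => rfl
  have e2 : Fin.castLE (Nat.succ_le_of_lt i.isLt) (Fin.last (i : ℕ)) = i := rfl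
  apply hne
  have e3 : ∑ x : Fin (i : ℕ), w (Fin.castLE (Nat.succ_le_of_lt i.isLt) x.castSucc) τ
      = ∑ x : Fin (i : ℕ), w (Fin.castLE i.isLt.le x) τ := rfl
  rw [e2, e3] at h2
  linarith
end
end

section
/- (Proposition 5.1: transformers can fit SLALOM.) For any finite vocabulary V, any maps s, v : V → ℝ, and any dimensions d ≥ 3 and d_h ≥ 3, there exist an embedding map e : V → ℝ^d and single-layer, single-head transformer parameters W_Q, W_K, W_V ∈ ℝ^{d×d_h}, b_Q, b_K, b_V ∈ ℝ^{d_h}, a linear projection P : ℝ^{d_h} → ℝ^d, a map ffn : ℝ^d → ℝ^d, and a linear classification map cls : ℝ^d → ℝ^2, such that for every nonempty sequence t = [t_1,…,t_n] of tokens from V, the transformer's log-odds output equals the SLALOM value: F(t) = Σ_{i=1}^n α_i(t) v(t_i) with α_i(t) = exp(s(t_i)) / Σ_{j=1}^n exp(s(t_j)). -/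
open scoped BigOperators

noncomputable section

/-- The softmax-linked additive log-odds model (SLALOM) with importance map `s` and
value map `v`: `F(t) = Σ_i α_i(t) v(t_i)` with `α_i(t) = exp(s(t_i)) / Σ_j exp(s(t_j))`. -/
def slalom {V : Type*} (s v : V → ℝ) {n : ℕ} (t : Fin n → V) : ℝ :=
  ∑ i, (Real.exp (s (t i)) / ∑ j, Real.exp (s (t j))) * v (t i)

/-- Proposition 5.1: for any maps `s, v : V → ℝ` and any dimensions
`d, dh ≥ 3`, there is a single-layer, single-head transformer (encoder variant: full
attention, classification on the first token) with linear projection `P` and linear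
classification map `cls` whose log-odds output equals the SLALOM value on every
nonempty sequence. -/
theorem transformer_represents_slalom {V : Type*} [Fintype V] (s v : V → ℝ)
    (d dh : ℕ) (hd : 3 ≤ d) (hdh : 3 ≤ dh) :
    ∃ T : Transformer V d dh, IsLinearMap ℝ T.P ∧ IsLinearMap ℝ T.cls ∧
      ∀ (n : ℕ) (hn : 1 ≤ n) (t : Fin n → V),
        T.F false hn t = slalom s v t := by
  obtain ⟨d, rfl⟩ : ∃ k, d = k + 3 := ⟨d - 3, by omega⟩
  obtain ⟨m, rfl⟩ : ∃ k, dh = k + 3 := ⟨dh - 3, by omega⟩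
  have h2 : (2 : Fin (d + 3)) ≠ 0 := by
    simp [Fin.ext_iff, Nat.mod_eq_of_lt (show 2 < d + 3 by omega)]
  have h1 : (1 : Fin (d + 3)) ≠ 0 := by simp
  have h21 : (2 : Fin (d + 3)) ≠ 1 := by
    simp [Fin.ext_iff, Nat.mod_eq_of_lt (show 2 < d + 3 by omega)]
  let T : Transformer V (d + 3) (m + 3) :=
    { e := fun w i => if i = 0 then s w else if i = 1 then v w else 0
      WQ := fun _ _ => 0
      WK := fun i j => if i = 0 then (if j = 0 then 1 else 0) else 0
      WV := fun i j => if i = 1 then (if j = 0 then 1 else 0) else 0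
      bQ := fun j => if j = 0 then Real.sqrt ((m + 3 : ℕ) : ℝ) else 0
      bK := fun _ => 0
      bV := fun _ => 0
      P := fun x i => if i = 2 then x 0 else 0
      ffn := fun x => x
      cls := fun x i => if i = 1 then x 2 else 0 }
  have hq : ∀ h j, T.qvec h j = if j = 0 then Real.sqrt ((m + 3 : ℕ) : ℝ) else 0 := by
    intro h j; simp [Transformer.qvec, T]
  have hk : ∀ w, T.kvec (T.e w) 0 = s w := by
    intro w
    unfold Transformer.kvec
    rw [Finset.sum_eq_single 0 (fun i _ hi => by simp [T, hi]) (by simp)]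
    simp [T]
  have hv : ∀ w, T.vvec (T.e w) 0 = v w := by
    intro w
    unfold Transformer.vvec
    rw [Finset.sum_eq_single 1 (fun i _ hi => by simp [T, hi]) (by simp)]
    simp [T]
  have hpos : Real.sqrt ((m + 3 : ℕ) : ℝ) ≠ 0 := by positivity
  have hsc : ∀ (n : ℕ) (t : Fin n → V) (i j : Fin n),
      T.score t i j = Real.exp (s (t j)) := by
    intro n t i j
    unfold Transformer.score dotp
    congr 1
    simp only [hq, ite_mul, zero_mul, Finset.sum_ite_eq', Finset.mem_univ, if_true, hk,
      Finset.sum_ite_eq]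
    exact mul_div_cancel_left₀ _ hpos
  refine ⟨T, ?_, ?_, ?_⟩
  · constructor
    · intro x y; ext i; by_cases h : i = 2 <;> simp [T, h]
    · intro c x; ext i; by_cases h : i = 2 <;> simp [T, h]
  · constructor
    · intro x y; ext i; by_cases h : i = 1 <;> simp [T, h]
    · intro c x; ext i; by_cases h : i = 1 <;> simp [T, h]
  · intro n hn t
    have hF : T.F false hn t = T.sout false t (Transformer.clsIdx false hn) 0 := by
      simp [Transformer.F, T, h2, h21]
    rw [hF]
    simp [Transformer.sout, Finset.sum_apply, Transformer.attn, Transformer.J, hsc, hv, slalom]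
end
end

section
/- (Proposition 5.2: identifiability/recovery of SLALOMs.) Fix a finite vocabulary V and a normalization constant γ ∈ ℝ. Let (s, v) and (s', v') be two pairs of maps V → ℝ, each satisfying the normalization constraint Σ_{τ∈V} s(τ) = γ and Σ_{τ∈V} s'(τ) = γ, and let F and F' be the corresponding SLALOMs. Suppose F is non-constant (it takes two different values on nonempty sequences) and F(t) = F'(t) for every sequence t of length 1 or 2 over V. Then s = s' and v = v'; i.e., a non-constant SLALOM satisfying the normalization constraint is uniquely determined by its values on sequences of length at most 2. -/
open scoped BigOperators

noncomputable section

/-- Proposition 5.2, identifiability/recovery of SLALOMs: two SLALOMs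
whose importance maps both satisfy the normalization constraint `Σ_τ s(τ) = γ`, one of
which is non-constant, that agree on all sequences of length 1 or 2, have identical
parameter maps. -/
theorem slalom_identifiable {V : Type*} [Fintype V] (γ : ℝ) (s v s' v' : V → ℝ)
    (hs : ∑ τ : V, s τ = γ) (hs' : ∑ τ : V, s' τ = γ)
    (hnc : ∃ (n₁ n₂ : ℕ) (_ : 1 ≤ n₁) (_ : 1 ≤ n₂) (t₁ : Fin n₁ → V) (t₂ : Fin n₂ → V),
        slalom s v t₁ ≠ slalom s v t₂)
    (heq : ∀ (n : ℕ) (_ : 1 ≤ n) (_ : n ≤ 2) (t : Fin n → V),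
        slalom s v t = slalom s' v' t) :
    s = s' ∧ v = v' := by
  have hv : v = v' := by
    funext τ
    have h := heq 1 le_rfl (by norm_num) (fun _ => τ)
    simpa [slalom, (Real.exp_pos _).ne'] using h
  subst hv
  refine ⟨?_, rfl⟩
  have key : ∀ a b, v a ≠ v b → s a - s' a = s b - s' b := by
    intro a b hab
    have h := heq 2 (by norm_num) le_rfl ![a, b]
    simp only [slalom, Fin.sum_univ_two, Matrix.cons_val_zero, Matrix.cons_val_one] at h
    have h1 := Real.exp_pos (s a)
    have h2 := Real.exp_pos (s b)
    have h3 := Real.exp_pos (s' a)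
    have h4 := Real.exp_pos (s' b)
    have e : Real.exp (s a) * Real.exp (s' b) = Real.exp (s b) * Real.exp (s' a) := by
      rw [div_mul_eq_mul_div, div_mul_eq_mul_div, div_mul_eq_mul_div, div_mul_eq_mul_div,
        ← add_div, ← add_div, div_eq_div_iff (by positivity) (by positivity)] at h
      apply mul_left_cancel₀ (sub_ne_zero.mpr hab)
      linear_combination h
    rw [← Real.exp_add, ← Real.exp_add] at e
    have := Real.exp_injective e
    linarith
  have hex : ∃ a b, v a ≠ v b := by
    by_contra! hcon
    obtain ⟨n₁, n₂, hn₁, hn₂, t₁, t₂, hne⟩ := hnc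
    have c : ∀ (x : V) (n : ℕ) (_ : 1 ≤ n) (t : Fin n → V), slalom s v t = v x := by
      intro x n hn t
      haveI : Nonempty (Fin n) := ⟨⟨0, hn⟩⟩
      have hpos : 0 < ∑ j, Real.exp (s (t j)) :=
        Finset.sum_pos (fun i _ => Real.exp_pos _) Finset.univ_nonempty
      unfold slalom
      rw [Finset.sum_congr rfl (fun i _ => by rw [hcon (t i) x]), ← Finset.sum_mul,
        ← Finset.sum_div, div_self hpos.ne', one_mul]
    exact hne ((c (t₁ ⟨0, hn₁⟩) _ hn₁ t₁).trans (c _ _ hn₂ t₂).symm)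
  obtain ⟨a, b, hab⟩ := hex
  have hd : ∀ τ, s τ - s' τ = s a - s' a := by
    intro τ
    by_cases h : v τ = v a
    · rw [key τ b (h ▸ hab), key a b hab]
    · exact key τ a h
  have hsum : ∑ τ : V, (s τ - s' τ) = 0 := by
    rw [Finset.sum_sub_distrib, hs, hs', sub_self]
  rw [Finset.sum_congr rfl (fun τ _ => hd τ), Finset.sum_const, nsmul_eq_mul] at hsum
  haveI : Nonempty V := ⟨a⟩
  have hc : ((Finset.univ : Finset V).card : ℝ) ≠ 0 := by
    simp
  have h0 := (mul_eq_zero.mp hsum).resolve_left hc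
  funext τ
  have := hd τ
  linarith
end
end

section
/- (Linearized SLALOM scores: gradient of the weighted model.) Let s, v : V → ℝ define a SLALOM, let t = [t_1,…,t_n] be a nonempty sequence, and let F(λ) = (Σ_{i=1}^n λ_i exp(s(t_i)) v(t_i)) / (Σ_{i=1}^n λ_i exp(s(t_i))) be the weighted model. Then for each i, the partial derivative of F with respect to λ_i at λ = 1 (the all-ones vector) equals α_i(t) · (v(t_i) − F(1)), where α_i(t) = exp(s(t_i)) / Σ_{j=1}^n exp(s(t_j)) and F(1) is the SLALOM value of t; in particular, this partial derivative is proportional to exp(s(t_i)) · (v(t_i) − F(1)) with a proportionality factor independent of i. -/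
open scoped BigOperators

noncomputable section

/-- The weighted (soft-removal) SLALOM model on a fixed sequence `t`:
`F(λ) = (Σ_i λ_i exp(s(t_i)) v(t_i)) / (Σ_i λ_i exp(s(t_i)))`. -/
def weighted {V : Type*} (s v : V → ℝ) {n : ℕ} (t : Fin n → V) (lam : Fin n → ℝ) : ℝ :=
  (∑ i, lam i * Real.exp (s (t i)) * v (t i)) / (∑ i, lam i * Real.exp (s (t i)))

/-- linearized SLALOM scores: the partial derivative of the weighted model
with respect to `λ_i` at `λ = 1` equals `α_i(t) · (v(t_i) − F(1))`, where
`α_i(t) = exp(s(t_i)) / Σ_j exp(s(t_j))` and `F(1)` is the SLALOM value of `t`; in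
particular it is proportional to `exp(s(t_i)) · (v(t_i) − F(1))` with a proportionality
factor independent of `i`. -/
theorem weighted_slalom_gradient {V : Type*} [Fintype V] (s v : V → ℝ)
    (n : ℕ) (hn : 1 ≤ n) (t : Fin n → V) :
    (∀ i : Fin n,
      HasDerivAt
        (fun x : ℝ => weighted s v t (Function.update (fun _ : Fin n => (1 : ℝ)) i x))
        ((Real.exp (s (t i)) / ∑ j, Real.exp (s (t j))) * (v (t i) - slalom s v t)) 1) ∧
    (∃ c : ℝ, ∀ i : Fin n,
      (Real.exp (s (t i)) / ∑ j, Real.exp (s (t j))) * (v (t i) - slalom s v t)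
        = c * (Real.exp (s (t i)) * (v (t i) - slalom s v t))) := by
  have key : ∀ (i : Fin n) (w : Fin n → ℝ) (x : ℝ),
      ∑ j, Function.update (fun _ : Fin n => (1 : ℝ)) i x j * w j
        = ∑ j, w j + (x - 1) * w i := by
    intro i w x
    have h : ∀ j, Function.update (fun _ : Fin n => (1 : ℝ)) i x j * w j
        = w j + if j = i then (x - 1) * w i else 0 := by
      intro j
      by_cases hj : j = i
      · subst hj
        simp
        ring
      · simp [hj]
    simp only [h, Finset.sum_add_distrib]
    simp
  have hpos : 0 < ∑ j, Real.exp (s (t j)) :=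
    Finset.sum_pos (fun j _ => Real.exp_pos _) ⟨⟨0, hn⟩, Finset.mem_univ _⟩
  have hsl : slalom s v t
      = (∑ j, Real.exp (s (t j)) * v (t j)) / ∑ j, Real.exp (s (t j)) := by
    unfold slalom
    rw [Finset.sum_div]
    exact Finset.sum_congr rfl fun j _ => by ring
  refine ⟨fun i => ?_, (∑ j, Real.exp (s (t j)))⁻¹, fun i => by ring⟩
  rw [hsl]
  unfold weighted
  simp only [mul_assoc]
  simp only [key i (fun j => Real.exp (s (t j)) * v (t j)), key i (fun j => Real.exp (s (t j)))]
  have lin : ∀ a b : ℝ, HasDerivAt (fun x : ℝ => a + (x - 1) * b) b 1 := by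
    intro a b
    simpa using (((hasDerivAt_id (1 : ℝ)).sub_const 1).mul_const b).const_add a
  have hd := (lin (∑ j, Real.exp (s (t j)) * v (t j)) (Real.exp (s (t i)) * v (t i))).div
    (lin (∑ j, Real.exp (s (t j))) (Real.exp (s (t i)))) (by simpa using hpos.ne')
  refine hd.congr_deriv ?_
  have := hpos.ne'
  simp only [sub_self, zero_mul, add_zero]
  field_simp
end
end
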